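/- arXiv:1902.01056 — 4 statements merged into one kernel-verified Lean document; each statement's English description precedes it below -/
import Mathlib

section
/- Let d, K be integers with K ≥ 2, let x ∈ ℝ^d be nonzero, let w_{1,t}, …, w_{K,t} ∈ ℝ^d, let ỹ ∈ {1, …, K}, let β ∈ (0, 1], and let ℓ_t = min_{i ∈ {1,…,K}\{ỹ}} (1 − w_i,t·x + w_{ỹ,t}·x). If (w_1*, …, w_K*) minimizes Σ_{i=1}^K ‖w_i − w_{i,t}‖² over the feasible set F = { (w_1, …, w_K) ∈ (ℝ^d)^K : min_{i ∈ {1,…,K}\{ỹ}} (1 − w_i·x + w_ỹ·x) ≤ (1−β)ℓ_t and w_i·x − w_j·x = w_{i,t}·x − w_{j,t}·x for all i, j ∈ {1,…,K}\{ỹ} }, then for every i ∈ {1, …, K} there exists τ_i ∈ ℝ such that w_i* = w_{i,t} + τ_i x. -/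
open scoped RealInnerProductSpace

section

variable {E : Type*} [NormedAddCommGroup E] [InnerProductSpace ℝ E]

/-- The component of `v` along `x` has the same inner product with `x` as `v`. -/
theorem inner_smul_div_norm_sq_self {x : E} (hx : x ≠ 0) (v : E) :
    ⟪(⟪v, x⟫ / ‖x‖ ^ 2) • x, x⟫ = ⟪v, x⟫ := by
  have : ‖x‖ ≠ 0 := norm_ne_zero_iff.mpr hx
  rw [real_inner_smul_left, real_inner_self_eq_norm_sq]
  field_simp

/-- Pythagoras for the decomposition of `v` along `x` and its orthogonal complement. -/
theorem norm_sq_eq_norm_sq_smul_add_norm_sq_sub {x : E} (hx : x ≠ 0) (v : E) :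
    ‖v‖ ^ 2 = ‖(⟪v, x⟫ / ‖x‖ ^ 2) • x‖ ^ 2 + ‖v - (⟪v, x⟫ / ‖x‖ ^ 2) • x‖ ^ 2 := by
  have h : ⟪(⟪v, x⟫ / ‖x‖ ^ 2) • x, v - (⟪v, x⟫ / ‖x‖ ^ 2) • x⟫ = 0 := by
    rw [real_inner_smul_left, inner_sub_right, real_inner_comm _ x, real_inner_comm _ x,
      inner_smul_div_norm_sq_self hx, sub_self, mul_zero]
  have := norm_add_sq_real ((⟪v, x⟫ / ‖x‖ ^ 2) • x) (v - (⟪v, x⟫ / ‖x‖ ^ 2) • x)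
  rw [add_sub_cancel, h] at this
  linarith

/-- If the feasibility of a family of vectors depends only on its inner products with `x`, a
feasible family closest to `w₀` differs from `w₀` only along `x`. -/
theorem exists_eq_add_smul_of_forall_sum_norm_sq_le {ι : Type*} [Fintype ι] {x : E} (hx : x ≠ 0)
    {F : Set (ι → E)} (hF : ∀ w ∈ F, ∀ w' : ι → E, (∀ i, ⟪w' i, x⟫ = ⟪w i, x⟫) → w' ∈ F)
    {w₀ w : ι → E} (hw : w ∈ F)
    (hmin : ∀ w' ∈ F, ∑ i, ‖w i - w₀ i‖ ^ 2 ≤ ∑ i, ‖w' i - w₀ i‖ ^ 2) (i : ι) :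
    ∃ τ : ℝ, w i = w₀ i + τ • x := by
  let τ : ι → ℝ := fun i => ⟪w i - w₀ i, x⟫ / ‖x‖ ^ 2
  have hle := hmin (fun i => w₀ i + τ i • x) <| hF w hw _ fun i => by
    rw [inner_add_left, inner_smul_div_norm_sq_self hx, inner_sub_left, add_sub_cancel]
  simp only [add_sub_cancel_left] at hle
  have hsum : ∑ i, ‖w i - w₀ i‖ ^ 2 =
      ∑ i, ‖τ i • x‖ ^ 2 + ∑ i, ‖w i - w₀ i - τ i • x‖ ^ 2 := by
    rw [← Finset.sum_add_distrib]
    exact Finset.sum_congr rfl fun i _ => norm_sq_eq_norm_sq_smul_add_norm_sq_sub hx _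
  have hi : ‖w i - w₀ i - τ i • x‖ ^ 2 ≤ ∑ i, ‖w i - w₀ i - τ i • x‖ ^ 2 :=
    Finset.single_le_sum (f := fun i => ‖w i - w₀ i - τ i • x‖ ^ 2)
      (fun _ _ => sq_nonneg _) (Finset.mem_univ i)
  have hzero : ‖w i - w₀ i - τ i • x‖ = 0 := by
    rw [← sq_eq_zero_iff]
    exact le_antisymm (by linarith) (sq_nonneg _)
  refine ⟨τ i, ?_⟩
  rw [← sub_eq_iff_eq_add']
  exact sub_eq_zero.mp (norm_eq_zero.mp hzero)

end

/-- Lemma 1 of the paper: the minimizer of the CSPA constrained projection problem for a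
wrong proposed label `yt` moves each weight vector only along the direction of `x`. -/
theorem cspa_update_along_x (d K : ℕ) (hK : 2 ≤ K)
    (x : EuclideanSpace ℝ (Fin d)) (hx : x ≠ 0)
    (wt : Fin K → EuclideanSpace ℝ (Fin d)) (yt : Fin K)
    (β : ℝ) (hβ : β ∈ Set.Ioc (0 : ℝ) 1)
    (ℓt : ℝ)
    (hℓt : ℓt = (Finset.univ.erase yt).inf'
      (by
        rw [← Finset.card_pos, Finset.card_erase_of_mem (Finset.mem_univ yt),
          Finset.card_univ, Fintype.card_fin]
        omega)
      (fun i => 1 - ⟪wt i, x⟫ + ⟪wt yt, x⟫))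
    (F : Set (Fin K → EuclideanSpace ℝ (Fin d)))
    (hF : F = {w | (Finset.univ.erase yt).inf'
        (by
          rw [← Finset.card_pos, Finset.card_erase_of_mem (Finset.mem_univ yt),
            Finset.card_univ, Fintype.card_fin]
          omega)
        (fun i => 1 - ⟪w i, x⟫ + ⟪w yt, x⟫) ≤ (1 - β) * ℓt ∧
      ∀ i ∈ Finset.univ.erase yt, ∀ j ∈ Finset.univ.erase yt,
        ⟪w i, x⟫ - ⟪w j, x⟫ = ⟪wt i, x⟫ - ⟪wt j, x⟫})
    (wstar : Fin K → EuclideanSpace ℝ (Fin d))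
    (hmem : wstar ∈ F)
    (hmin : ∀ w ∈ F, ∑ i, ‖wstar i - wt i‖ ^ 2 ≤ ∑ i, ‖w i - wt i‖ ^ 2) :
    ∀ i : Fin K, ∃ τ : ℝ, wstar i = wt i + τ • x := by
  refine exists_eq_add_smul_of_forall_sum_norm_sq_le hx (fun w hw w' h => ?_) hmem hmin
  subst hF
  simpa only [Set.mem_ofPred_eq, h] using hw
end

section
/- Let K ≥ 2 be an integer and let a > 0 and c > 0 be real numbers. Then the pair (τ, τ_y) = (c/(K a), −(K−1)c/(K a)) is the unique minimizer of the function f(τ, τ_y) = ((K−1)/2)τ² + (1/2)τ_y² over the set {(τ, τ_y) ∈ ℝ² : c − (τ − τ_y)·a ≤ 0}. -/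
/-- Completing the square for the reduced objective around `(t, -(k - 1) t)`. -/
theorem reduced_objective_expand (k t x y : ℝ) :
    (k - 1) / 2 * x ^ 2 + 1 / 2 * y ^ 2 =
      (k - 1) / 2 * t ^ 2 + 1 / 2 * (-(k - 1) * t) ^ 2 +
        ((k - 1) / 2 * (x - t) ^ 2 + 1 / 2 * (y + (k - 1) * t) ^ 2 +
          (k - 1) * t * (x - y - k * t)) := by
  ring

/-- The closed-form solution of the reduced CSPA optimization problem:
`(τ, τ_y) = (c/(K a), -(K-1)c/(K a))` is the unique minimizer of
`f (τ, τ_y) = ((K-1)/2) τ² + (1/2) τ_y²` subject to `c - (τ - τ_y) a ≤ 0`. -/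
theorem cspa_reduced_unique_minimizer (K : ℕ) (hK : 2 ≤ K) (a c : ℝ)
    (ha : 0 < a) (hc : 0 < c)
    (f : ℝ × ℝ → ℝ)
    (hf : f = fun p => ((K : ℝ) - 1) / 2 * p.1 ^ 2 + (1 / 2) * p.2 ^ 2)
    (p : ℝ × ℝ) (hp : p = (c / (K * a), -((K : ℝ) - 1) * c / (K * a))) :
    (c - (p.1 - p.2) * a ≤ 0) ∧
      (∀ q : ℝ × ℝ, c - (q.1 - q.2) * a ≤ 0 → f p ≤ f q) ∧
      (∀ q : ℝ × ℝ, c - (q.1 - q.2) * a ≤ 0 → f q = f p → q = p) := by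
  subst hf hp
  have hk : (0 : ℝ) < (K : ℝ) - 1 := by
    have : (2 : ℝ) ≤ K := by exact_mod_cast hK
    linarith
  have hK0 : (0 : ℝ) < K := by linarith
  obtain ⟨t, ht⟩ : ∃ t, t = c / (K * a) := ⟨_, rfl⟩
  have ht0 : 0 < t := by rw [ht]; positivity
  have hct : c = K * t * a := by rw [ht]; field_simp
  rw [mul_div_assoc, ← ht]
  have feasible : ∀ q : ℝ × ℝ, c - (q.1 - q.2) * a ≤ 0 →
      0 ≤ ((K : ℝ) - 1) * t * (q.1 - q.2 - K * t) := by
    intro q hq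
    have : K * t ≤ q.1 - q.2 := le_of_mul_le_mul_right (by linarith) ha
    exact mul_nonneg (by positivity) (by linarith)
  refine ⟨?_, fun q hq => ?_, fun q hq hfq => ?_⟩
  · rw [hct]
    exact le_of_eq (by ring)
  · have h := feasible q hq
    dsimp only
    rw [reduced_objective_expand K t q.1 q.2]
    have : 0 ≤ ((K : ℝ) - 1) / 2 * (q.1 - t) ^ 2 := by positivity
    have : 0 ≤ 1 / 2 * (q.2 + ((K : ℝ) - 1) * t) ^ 2 := by positivity
    linarith
  · have h := feasible q hq
    dsimp only at hfq
    rw [reduced_objective_expand K t q.1 q.2] at hfq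
    have h₁ : 0 ≤ ((K : ℝ) - 1) / 2 * (q.1 - t) ^ 2 := by positivity
    have h₂ : 0 ≤ 1 / 2 * (q.2 + ((K : ℝ) - 1) * t) ^ 2 := by positivity
    have e₁ : ((K : ℝ) - 1) / 2 * (q.1 - t) ^ 2 = 0 := by linarith
    have e₂ : (q.2 + ((K : ℝ) - 1) * t) ^ 2 = 0 := by linarith
    have e₃ := pow_eq_zero_iff two_ne_zero |>.mp
      ((mul_eq_zero.mp e₁).resolve_left (by positivity))
    have e₄ := pow_eq_zero_iff two_ne_zero |>.mp e₂
    ext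
    · dsimp only; linarith
    · dsimp only; linarith
end

section
/- Let d, K be integers with K ≥ 2, let w_1, …, w_K ∈ ℝ^d, let x ∈ ℝ^d be nonzero, let ỹ ∈ {1, …, K}, let β ∈ ℝ, and set ℓ = min_{i ∈ {1,…,K}\{ỹ}} (1 − w_i·x + w_ỹ·x). Define the updated vectors w'_i = w_i + (βℓ/(K‖x‖²)) x for i ≠ ỹ and w'_ỹ = w_ỹ − ((K−1)βℓ/(K‖x‖²)) x. Then: (i) w'_i·x − w'_j·x = w_i·x − w_j·x for all i, j ∈ {1,…,K}\{ỹ}; and (ii) min_{i ∈ {1,…,K}\{ỹ}} (1 − w'_i·x + w'_ỹ·x) = (1−β)ℓ. -/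
open scoped RealInnerProductSpace

/-- The CPA update for a wrong proposed label `yt` preserves the pairwise score
differences among classes other than `yt` and reduces the complementary loss
exactly by the factor `(1 - β)`. -/
theorem cpa_update_properties (d K : ℕ) (hK : 2 ≤ K)
    (w : Fin K → EuclideanSpace ℝ (Fin d))
    (x : EuclideanSpace ℝ (Fin d)) (hx : x ≠ 0)
    (yt : Fin K) (β : ℝ)
    (ℓ : ℝ)
    (hℓ : ℓ = (Finset.univ.erase yt).inf'
      (by
        rw [← Finset.card_pos, Finset.card_erase_of_mem (Finset.mem_univ yt),
          Finset.card_univ, Fintype.card_fin]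
        omega)
      (fun i => 1 - ⟪w i, x⟫ + ⟪w yt, x⟫))
    (w' : Fin K → EuclideanSpace ℝ (Fin d))
    (hw'₁ : ∀ i : Fin K, i ≠ yt → w' i = w i + (β * ℓ / (K * ‖x‖ ^ 2)) • x)
    (hw'₂ : w' yt = w yt - ((K - 1 : ℝ) * β * ℓ / (K * ‖x‖ ^ 2)) • x) :
    (∀ i ∈ Finset.univ.erase yt, ∀ j ∈ Finset.univ.erase yt,
        ⟪w' i, x⟫ - ⟪w' j, x⟫ = ⟪w i, x⟫ - ⟪w j, x⟫) ∧
      (Finset.univ.erase yt).inf'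
        (by
          rw [← Finset.card_pos, Finset.card_erase_of_mem (Finset.mem_univ yt),
            Finset.card_univ, Fintype.card_fin]
          omega)
        (fun i => 1 - ⟪w' i, x⟫ + ⟪w' yt, x⟫) = (1 - β) * ℓ := by
  have hK0 : (K : ℝ) ≠ 0 := by
    have : K ≠ 0 := by omega
    exact_mod_cast this
  have hx0 : ‖x‖ ≠ 0 := norm_ne_zero_iff.mpr hx
  have score_of_ne : ∀ i, i ≠ yt → ⟪w' i, x⟫ = ⟪w i, x⟫ + β * ℓ / K := by
    intro i hi
    rw [hw'₁ i hi, inner_add_left, real_inner_smul_left, real_inner_self_eq_norm_sq]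
    field_simp
  have score_label : ⟪w' yt, x⟫ = ⟪w yt, x⟫ - (K - 1) * β * ℓ / K := by
    rw [hw'₂, inner_sub_left, real_inner_smul_left, real_inner_self_eq_norm_sq]
    field_simp
  refine ⟨fun i hi j hj => ?_, ?_⟩
  · rw [score_of_ne i (Finset.ne_of_mem_erase hi), score_of_ne j (Finset.ne_of_mem_erase hj)]
    ring
  · have loss_eq : ∀ i ∈ Finset.univ.erase yt, 1 - ⟪w' i, x⟫ + ⟪w' yt, x⟫ =
        (1 - ⟪w i, x⟫ + ⟪w yt, x⟫) + -(β * ℓ) := by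
      intro i hi
      rw [score_of_ne i (Finset.ne_of_mem_erase hi), score_label]
      field_simp
      ring
    rw [Finset.inf'_congr _ rfl loss_eq]
    refine (Finset.apply_inf'_eq_inf'_comp _ (fun t : ℝ => t + -(β * ℓ))
      fun a b => min_add_add_right a b _ |>.symm).symm.trans ?_
    rw [← hℓ]
    ring
end

section
/- Let d, K be integers with K ≥ 2, let x ∈ ℝ^d be nonzero, let w_{1,t}, …, w_{K,t} ∈ ℝ^d, let ỹ ∈ {1, …, K}, let β ∈ (0, 1], and set ℓ_t = min_{i ∈ {1,…,K}\{ỹ}} (1 − w_{i,t}·x + w_{ỹ,t}·x). Assume ℓ_t > 0. Then the vectors w'_i = w_{i,t} + (βℓ_t/(K‖x‖²)) x for i ≠ ỹ and w'_ỹ = w_{ỹ,t} − ((K−1)βℓ_t/(K‖x‖²)) x form the unique minimizer of Σ_{i=1}^K ‖w_i − w_{i,t}‖² over the feasible set F = { (w_1, …, w_K) : min_{i ∈ {1,…,K}\{ỹ}} (1 − w_i·x + w_ỹ·x) ≤ (1−β)ℓ_t and w_i·x − w_j·x = w_{i,t}·x − w_{j,t}·x for all i, j ∈ {1,…,K}\{ỹ}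 }. -/
open scoped RealInnerProductSpace

/-- Variational inequality for a projection: if `p - q` makes a nonnegative total inner product with
`w - p`, then `w` is farther from `q` than `p`, with a quadratic excess. -/
theorem sum_norm_sub_sq_add_le {ι E : Type*} [Fintype ι] [NormedAddCommGroup E]
    [InnerProductSpace ℝ E] (p q w : ι → E) (h : 0 ≤ ∑ i, ⟪p i - q i, w i - p i⟫) :
    ∑ i, ‖p i - q i‖ ^ 2 + ∑ i, ‖w i - p i‖ ^ 2 ≤ ∑ i, ‖w i - q i‖ ^ 2 := by
  have expand (i : ι) : ‖w i - q i‖ ^ 2 =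
      ‖p i - q i‖ ^ 2 + 2 * ⟪p i - q i, w i - p i⟫ + ‖w i - p i‖ ^ 2 := by
    rw [← norm_add_sq_real]
    congr 2
    abel
  simp only [expand, Finset.sum_add_distrib, ← Finset.mul_sum]
  linarith

/-- The explicit CPA update is the unique minimizer of the CSPA constrained
projection problem for a wrong proposed label `yt`. -/
theorem cpa_update_is_unique_minimizer (d K : ℕ) (hK : 2 ≤ K)
    (x : EuclideanSpace ℝ (Fin d)) (hx : x ≠ 0)
    (wt : Fin K → EuclideanSpace ℝ (Fin d)) (yt : Fin K)
    (β : ℝ) (hβ : β ∈ Set.Ioc (0 : ℝ) 1)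
    (ℓt : ℝ)
    (hℓt : ℓt = (Finset.univ.erase yt).inf'
      (by
        rw [← Finset.card_pos, Finset.card_erase_of_mem (Finset.mem_univ yt),
          Finset.card_univ, Fintype.card_fin]
        omega)
      (fun i => 1 - ⟪wt i, x⟫ + ⟪wt yt, x⟫))
    (hℓtpos : 0 < ℓt)
    (F : Set (Fin K → EuclideanSpace ℝ (Fin d)))
    (hF : F = {w | (Finset.univ.erase yt).inf'
        (by
          rw [← Finset.card_pos, Finset.card_erase_of_mem (Finset.mem_univ yt),
            Finset.card_univ, Fintype.card_fin]
          omega)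
        (fun i => 1 - ⟪w i, x⟫ + ⟪w yt, x⟫) ≤ (1 - β) * ℓt ∧
      ∀ i ∈ Finset.univ.erase yt, ∀ j ∈ Finset.univ.erase yt,
        ⟪w i, x⟫ - ⟪w j, x⟫ = ⟪wt i, x⟫ - ⟪wt j, x⟫})
    (w' : Fin K → EuclideanSpace ℝ (Fin d))
    (hw'₁ : ∀ i : Fin K, i ≠ yt → w' i = wt i + (β * ℓt / (K * ‖x‖ ^ 2)) • x)
    (hw'₂ : w' yt = wt yt - ((K - 1 : ℝ) * β * ℓt / (K * ‖x‖ ^ 2)) • x) :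
    w' ∈ F ∧
      (∀ w ∈ F, ∑ i, ‖w' i - wt i‖ ^ 2 ≤ ∑ i, ‖w i - wt i‖ ^ 2) ∧
      (∀ w ∈ F, ∑ i, ‖w i - wt i‖ ^ 2 = ∑ i, ‖w' i - wt i‖ ^ 2 → w = w') := by
  have hK0 : (0 : ℝ) < K := by exact_mod_cast (by omega : 0 < K)
  have hK1 : (1 : ℝ) ≤ K := by exact_mod_cast (by omega : 1 ≤ K)
  have hx0 : 0 < ‖x‖ ^ 2 := by positivity
  obtain ⟨a, ha⟩ : ∃ a, a = β * ℓt / (K * ‖x‖ ^ 2) := ⟨_, rfl⟩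
  have ha0 : 0 ≤ a := ha ▸ div_nonneg (mul_nonneg hβ.1.le hℓtpos.le) (by positivity)
  have haK : K * (a * ‖x‖ ^ 2) = β * ℓt := by
    rw [ha]
    field_simp
  have hy : w' yt = wt yt - ((K - 1) * a) • x := by
    rw [hw'₂, ha]
    congr 2
    ring
  rw [← ha] at hw'₁
  have inner_other (i : Fin K) (hi : i ≠ yt) : ⟪w' i, x⟫ = ⟪wt i, x⟫ + a * ‖x‖ ^ 2 := by
    rw [hw'₁ i hi, inner_add_left, real_inner_smul_left, real_inner_self_eq_norm_sq]
  have inner_label : ⟪w' yt, x⟫ = ⟪wt yt, x⟫ - (K - 1) * a * ‖x‖ ^ 2 := by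
    rw [hy, inner_sub_left, real_inner_smul_left, real_inner_self_eq_norm_sq]
  have excess (w : Fin K → EuclideanSpace ℝ (Fin d)) (hw : w ∈ F) :
      ∑ i, ‖w' i - wt i‖ ^ 2 + ∑ i, ‖w i - w' i‖ ^ 2 ≤ ∑ i, ‖w i - wt i‖ ^ 2 := by
    apply sum_norm_sub_sq_add_le
    rw [hF] at hw
    obtain ⟨hmin, hdiff⟩ := hw
    obtain ⟨k, hk, hkle⟩ := (Finset.inf'_le_iff _).1 hmin
    have hkt : ℓt ≤ 1 - ⟪wt k, x⟫ + ⟪wt yt, x⟫ := hℓt ▸ Finset.inf'_le _ hk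
    have term_other (i : Fin K) (hi : i ∈ Finset.univ.erase yt) :
        ⟪w' i - wt i, w i - w' i⟫ = a * (⟪w k, x⟫ - ⟪wt k, x⟫ - a * ‖x‖ ^ 2) := by
      have hi' := Finset.ne_of_mem_erase hi
      have hsub : w' i - wt i = a • x := by rw [hw'₁ i hi', add_sub_cancel_left]
      rw [hsub, real_inner_smul_left, real_inner_comm, inner_sub_left, inner_other i hi']
      linear_combination a * hdiff i hi k hk
    have term_label : ⟪w' yt - wt yt, w yt - w' yt⟫ =
        -((K - 1) * a) * (⟪w yt, x⟫ - ⟪wt yt, x⟫ + (K - 1) * a * ‖x‖ ^ 2) := by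
      have hsub : w' yt - wt yt = (-((K - 1) * a)) • x := by
        rw [hy, neg_smul]
        abel
      rw [hsub, real_inner_smul_left, real_inner_comm, inner_sub_left, inner_label]
      ring
    rw [← Finset.sum_erase_add _ _ (Finset.mem_univ yt), Finset.sum_congr rfl term_other,
      term_label, Finset.sum_const, Finset.card_erase_of_mem (Finset.mem_univ yt),
      Finset.card_univ, Fintype.card_fin, nsmul_eq_mul, Nat.cast_pred (by omega)]
    have hgap : 0 ≤ (⟪w k, x⟫ - ⟪wt k, x⟫) - (⟪w yt, x⟫ - ⟪wt yt, x⟫) - K * (a * ‖x‖ ^ 2) := by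
      linarith
    linear_combination mul_nonneg (mul_nonneg (sub_nonneg.2 hK1) ha0) hgap
  refine ⟨?_, fun w hw => ?_, fun w hw heq => ?_⟩
  · rw [hF]
    refine ⟨(Finset.inf'_le_iff _).2 ?_, fun i hi j hj => ?_⟩
    · obtain ⟨k, hk, hkt⟩ := Finset.exists_mem_eq_inf' (s := Finset.univ.erase yt) (by
        rw [← Finset.card_pos, Finset.card_erase_of_mem (Finset.mem_univ yt),
          Finset.card_univ, Fintype.card_fin]
        omega) (fun i => 1 - ⟪wt i, x⟫ + ⟪wt yt, x⟫)
      rw [← hℓt] at hkt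
      refine ⟨k, hk, ?_⟩
      rw [inner_other k (Finset.ne_of_mem_erase hk), inner_label]
      linarith
    · rw [inner_other i (Finset.ne_of_mem_erase hi), inner_other j (Finset.ne_of_mem_erase hj)]
      ring
  · have hsum : 0 ≤ ∑ i, ‖w i - w' i‖ ^ 2 := Finset.sum_nonneg fun i _ => sq_nonneg _
    linarith [excess w hw]
  · have hsum : ∑ i, ‖w i - w' i‖ ^ 2 = 0 :=
      le_antisymm (by linarith [excess w hw]) (Finset.sum_nonneg fun i _ => sq_nonneg _)
    funext i
    have hi := (Finset.sum_eq_zero_iff_of_nonneg fun i _ => sq_nonneg _).1 hsum i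
      (Finset.mem_univ i)
    exact sub_eq_zero.1 (norm_eq_zero.1 (pow_eq_zero_iff two_ne_zero |>.1 hi))
end
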